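/- For every h>0, every r>0 and every z∈ℂ with Re z<0 one has |∫₀^∞ t·e^{zt}(p_h(r,t) − p_0(r,t)) dt| ≤ ∫₀^∞ t·e^{(Re z)t} p_0(r,t) dt − exp(−h·r²/4)·∫₀^∞ t·e^{(Re z−h)t} p_0(r,t) dt. In kernel terms: |F_h^{(2)}(x,y;z) − G_0^{(2)}(x,y;z)| ≤ G_0^{(2)}(x,y;Re z) − G_0^{(2)}(x,y;Re z−h)·exp(−h|x−y|²/4), where the superscript (2) refers to squared-resolvent kernels. -/

import Mathlib

open MeasureTheory Real Set

/-- Modulus of the Landau heat kernel at distance `r`. -/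
noncomputable def landauHeatKernel (h r t : ℝ) : ℝ :=
  h / (4 * π * Real.sinh (h * t)) *
    Real.exp (-(h * r ^ 2 * (Real.cosh (h * t) / Real.sinh (h * t))) / 4)

/-- Free heat kernel on `ℝ²` at distance `r`. -/
noncomputable def freeHeatKernel (r t : ℝ) : ℝ :=
  1 / (4 * π * t) * Real.exp (-(r ^ 2) / (4 * t))

lemma Real.sinh_le_self_mul_cosh {x : ℝ} (hx : 0 ≤ x) : Real.sinh x ≤ x * Real.cosh x := by
  have hd (y : ℝ) : HasDerivAt (fun y ↦ y * Real.cosh y - Real.sinh y) (y * Real.sinh y) y := by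
    have := ((hasDerivAt_id y).mul (Real.hasDerivAt_cosh y)).sub (Real.hasDerivAt_sinh y)
    refine this.congr_deriv ?_
    simp
  have hmono : MonotoneOn (fun y ↦ y * Real.cosh y - Real.sinh y) (Ici 0) := by
    refine monotoneOn_of_deriv_nonneg (convex_Ici 0)
      (fun y _ ↦ (hd y).continuousAt.continuousWithinAt)
      (fun y _ ↦ (hd y).differentiableAt.differentiableWithinAt) fun y hy ↦ ?_
    rw [interior_Ici, mem_Ioi] at hy
    rw [(hd y).deriv]
    exact mul_nonneg hy.le (Real.sinh_nonneg_iff.2 hy.le)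
  have := hmono self_mem_Ici hx hx
  simp only [Real.sinh_zero, zero_mul, sub_zero] at this
  linarith

lemma Real.sinh_le_self_mul_exp (x : ℝ) : Real.sinh x ≤ x * Real.exp x := by
  have h1 : -(2 * x) + 1 ≤ Real.exp (-(2 * x)) := Real.add_one_le_exp _
  have h2 : Real.exp (-x) = Real.exp x * Real.exp (-(2 * x)) := by
    rw [← Real.exp_add]; ring_nf
  rw [Real.sinh_eq, h2]
  nlinarith [mul_le_mul_of_nonneg_left h1 (Real.exp_pos x).le]

lemma Real.self_mul_exp_neg_le_sinh (x : ℝ) : x * Real.exp (-x) ≤ Real.sinh x := by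
  have := Real.sinh_le_self_mul_exp (-x)
  rw [Real.sinh_neg] at this
  linarith

lemma freeHeatKernel_nonneg (r : ℝ) {t : ℝ} (ht : 0 ≤ t) : 0 ≤ freeHeatKernel r t := by
  unfold freeHeatKernel
  positivity

lemma landauHeatKernel_le_freeHeatKernel {h t : ℝ} (r : ℝ) (hh : 0 < h) (ht : 0 < t) :
    landauHeatKernel h r t ≤ freeHeatKernel r t := by
  have hx : 0 < h * t := mul_pos hh ht
  have hs : 0 < Real.sinh (h * t) := Real.sinh_pos_iff.2 hx
  unfold landauHeatKernel freeHeatKernel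
  refine mul_le_mul ?_ (Real.exp_le_exp.2 ?_) (Real.exp_pos _).le (by positivity)
  · rw [div_le_div_iff₀ (by positivity) (by positivity)]
    have := mul_le_mul_of_nonneg_left (Real.self_le_sinh_iff.2 hx.le) Real.pi_pos.le
    linarith
  · have hc : 1 / t ≤ h * (Real.cosh (h * t) / Real.sinh (h * t)) := by
      rw [← mul_div_assoc, div_le_div_iff₀ ht hs]
      linarith [Real.sinh_le_self_mul_cosh hx.le]
    have := mul_le_mul_of_nonneg_left hc (sq_nonneg r)
    have he : -r ^ 2 / (4 * t) = -(r ^ 2 * (1 / t)) / 4 := by field_simp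
    rw [he]
    linarith

lemma exp_mul_freeHeatKernel_le_landauHeatKernel {h t : ℝ} (r : ℝ) (hh : 0 < h) (ht : 0 < t) :
    Real.exp (-(h * r ^ 2) / 4) * (Real.exp (-(h * t)) * freeHeatKernel r t) ≤
      landauHeatKernel h r t := by
  have hx : 0 < h * t := mul_pos hh ht
  have hs : 0 < Real.sinh (h * t) := Real.sinh_pos_iff.2 hx
  unfold landauHeatKernel freeHeatKernel
  calc _ = Real.exp (-(h * t)) / (4 * π * t) *
        Real.exp (-(h * r ^ 2) / 4 + -(r ^ 2) / (4 * t)) := by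
        rw [Real.exp_add]; ring
    _ ≤ _ := by
      refine mul_le_mul ?_ (Real.exp_le_exp.2 ?_) (Real.exp_pos _).le (by positivity)
      · rw [div_le_div_iff₀ (by positivity) (by positivity)]
        have h1 : Real.exp (-(h * t)) * Real.sinh (h * t) ≤ h * t := by
          have := mul_le_mul_of_nonneg_left (Real.sinh_le_self_mul_exp (h * t))
            (Real.exp_pos (-(h * t))).le
          rwa [mul_left_comm, ← Real.exp_add, neg_add_cancel, Real.exp_zero, mul_one] at this
        have := mul_le_mul_of_nonneg_left h1 Real.pi_pos.le
        linarith
      · have hc : h * (Real.cosh (h * t) / Real.sinh (h * t)) ≤ h + 1 / t := by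
          rw [← mul_div_assoc, div_le_iff₀ hs]
          have h1 := Real.self_mul_exp_neg_le_sinh (h * t)
          rw [← Real.cosh_sub_sinh] at h1
          have h2 : h * (Real.cosh (h * t) - Real.sinh (h * t)) ≤ 1 / t * Real.sinh (h * t) := by
            rw [one_div_mul_eq_div, le_div_iff₀ ht]
            linarith
          linarith
        have := mul_le_mul_of_nonneg_left hc (sq_nonneg r)
        have he : -r ^ 2 / (4 * t) = -(r ^ 2 * (1 / t)) / 4 := by field_simp
        rw [he]
        linarith

lemma integrableOn_mul_exp_mul_freeHeatKernel (r : ℝ) {a : ℝ} (ha : a < 0) :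
    IntegrableOn (fun t ↦ t * Real.exp (a * t) * freeHeatKernel r t) (Ioi 0) := by
  refine ((integrableOn_exp_mul_Ioi ha 0).const_mul (1 / (4 * π))).mono' ?_ ?_
  · unfold freeHeatKernel
    exact Measurable.aestronglyMeasurable (by fun_prop)
  · refine (ae_restrict_mem measurableSet_Ioi).mono fun t ht ↦ ?_
    rw [mem_Ioi] at ht
    rw [Real.norm_of_nonneg (mul_nonneg (by positivity) (freeHeatKernel_nonneg r ht.le))]
    have he : Real.exp (-(r ^ 2) / (4 * t)) ≤ 1 := by
      rw [Real.exp_le_one_iff, neg_div]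
      exact neg_nonpos.2 (by positivity)
    calc t * Real.exp (a * t) * freeHeatKernel r t
        = 1 / (4 * π) * Real.exp (a * t) * Real.exp (-(r ^ 2) / (4 * t)) := by
          unfold freeHeatKernel; field_simp
      _ ≤ _ := mul_le_of_le_one_right (by positivity) he

/-- For `h>0`, `r>0` and `z∈ℂ` with `Re z<0`:
`|∫₀^∞ t e^{zt}(p_h(r,t) − p_0(r,t)) dt| ≤
  ∫₀^∞ t e^{(Re z)t} p_0(r,t) dt − exp(−h r²/4) ∫₀^∞ t e^{(Re z−h)t} p_0(r,t) dt`.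
In kernel terms:
`|F_h^{(2)}(x,y;z) − G_0^{(2)}(x,y;z)| ≤ G_0^{(2)}(x,y;Re z) − G_0^{(2)}(x,y;Re z−h) exp(−h|x−y|²/4)`. -/
theorem landau_squared_resolvent_comparison (h r : ℝ) (z : ℂ)
    (hh : 0 < h) (hr : 0 < r) (hz : z.re < 0) :
    ‖∫ t in Ioi (0 : ℝ),
        (t : ℂ) * Complex.exp (z * t) * ((landauHeatKernel h r t - freeHeatKernel r t : ℝ) : ℂ)‖ ≤
      (∫ t in Ioi (0 : ℝ), t * Real.exp (z.re * t) * freeHeatKernel r t) -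
        Real.exp (-(h * r ^ 2) / 4) *
          ∫ t in Ioi (0 : ℝ), t * Real.exp ((z.re - h) * t) * freeHeatKernel r t := by
  have h0 := integrableOn_mul_exp_mul_freeHeatKernel r hz
  have h1 := (integrableOn_mul_exp_mul_freeHeatKernel r
    (show z.re - h < 0 by linarith)).const_mul (Real.exp (-(h * r ^ 2) / 4))
  rw [← integral_const_mul, ← integral_sub h0 h1]
  refine norm_integral_le_of_norm_le (h0.sub h1) ?_
  refine (ae_restrict_mem measurableSet_Ioi).mono fun t ht ↦ ?_
  rw [mem_Ioi] at ht
  have hle := landauHeatKernel_le_freeHeatKernel r hh ht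
  have hge := exp_mul_freeHeatKernel_le_landauHeatKernel r hh ht
  rw [norm_mul, norm_mul, Complex.norm_real, Complex.norm_real, Complex.norm_exp,
    Complex.re_mul_ofReal, Real.norm_of_nonneg ht.le, Real.norm_of_nonpos (by linarith)]
  have hw : 0 ≤ t * Real.exp (z.re * t) := by positivity
  have he : Real.exp ((z.re - h) * t) = Real.exp (z.re * t) * Real.exp (-(h * t)) := by
    rw [← Real.exp_add]; ring_nf
  simp only [he]
  linarith [mul_le_mul_of_nonneg_left hge hw]
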